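/- For f(z) = ∑_{n≥0} a_n z^n with (a_n) ∈ ℓ¹ and T the unilateral shift on ℓ²(ℕ), the operator norm of f(T) equals ‖f‖_∞ = sup_{|z|≤1} |f(z)|. -/

import Mathlib

open MeasureTheory Filter Topology

theorem norm_toLp_mul_le {X : Type*} [TopologicalSpace X] [CompactSpace X] [MeasurableSpace X]
    [BorelSpace X] (μ : Measure X) [IsFiniteMeasure μ] {g : C(X, ℂ)} {M : ℝ}
    (hg : ∀ x, ‖g x‖ ≤ M) (p : C(X, ℂ)) :
    ‖ContinuousMap.toLp (E := ℂ) 2 μ ℂ (g * p)‖ ≤ M * ‖ContinuousMap.toLp (E := ℂ) 2 μ ℂ p‖ := by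
  apply Lp.norm_le_mul_norm_of_ae_le_mul
  filter_upwards [ContinuousMap.coeFn_toLp (p := 2) (𝕜 := ℂ) μ (g * p),
    ContinuousMap.coeFn_toLp (p := 2) (𝕜 := ℂ) μ p] with x h₁ h₂
  rw [h₁, h₂, ContinuousMap.mul_apply, norm_mul]
  gcongr
  exact hg x

/-- Convergence of an operator power series, evaluated at `x`, under a continuous
linear map `φ`. -/
theorem hasSum_apply_pow {E G : Type*} [NormedAddCommGroup E] [NormedSpace ℂ E]
    [NormedAddCommGroup G] [NormedSpace ℂ G] {T F : E →L[ℂ] E} {a : ℕ → ℂ}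
    (hF : HasSum (fun n : ℕ => a n • (T ^ n)) F) (φ : E →L[ℂ] G) (x : E) :
    HasSum (fun n => a n • φ ((T ^ n) x)) (φ (F x)) := by
  simpa using (hF.mapL (ContinuousLinearMap.apply ℂ E x)).mapL φ

section Shift

variable {T : lp (fun _ : ℕ => ℂ) 2 →L[ℂ] lp (fun _ : ℕ => ℂ) 2}

theorem shift_pow_single (hT : ∀ n : ℕ, T (lp.single 2 n (1 : ℂ)) = lp.single 2 (n + 1) (1 : ℂ))
    (n i : ℕ) : (T ^ n) (lp.single 2 i (1 : ℂ)) = lp.single 2 (n + i) (1 : ℂ) := by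
  induction n with
  | zero => simp
  | succ n ih => rw [pow_succ', mul_apply_eq_comp, ih, hT, Nat.add_right_comm]

theorem single_eq_smul_one (i : ℕ) (c : ℂ) :
    (lp.single 2 i c : lp (fun _ : ℕ => ℂ) 2) = c • lp.single 2 i (1 : ℂ) := by
  rw [← lp.single_smul, smul_eq_mul, mul_one]

theorem norm_le_norm_shift_series_of_norm_lt_one
    (hT : ∀ n : ℕ, T (lp.single 2 n (1 : ℂ)) = lp.single 2 (n + 1) (1 : ℂ))
    {a : ℕ → ℂ} {F : lp (fun _ : ℕ => ℂ) 2 →L[ℂ] lp (fun _ : ℕ => ℂ) 2}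
    (hF : HasSum (fun n : ℕ => a n • (T ^ n)) F) {z w : ℂ} (hz : ‖z‖ < 1)
    (hw : HasSum (fun n : ℕ => a n * z ^ n) w) : ‖w‖ ≤ ‖F‖ := by
  have hk : Memℓp (fun n : ℕ => (starRingEnd ℂ z) ^ n) 2 := by
    apply memℓp_gen
    have : Summable fun n : ℕ => (‖z‖ ^ 2) ^ n :=
      summable_geometric_of_lt_one (by positivity) (by nlinarith [norm_nonneg z])
    refine this.congr fun n => ?_
    simp [← pow_mul, mul_comm]
  let k : lp (fun _ : ℕ => ℂ) 2 := ⟨_, hk⟩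
  have hk0 : k ≠ 0 := fun h => by
    have : k 0 = 0 := by rw [h]; rfl
    simp [k] at this
  let φ : lp (fun _ : ℕ => ℂ) 2 →L[ℂ] ℂ := innerSL ℂ k
  have hφs (n : ℕ) : φ (lp.single 2 n (1 : ℂ)) = z ^ n := by
    simp [φ, k, lp.inner_single_right]
  have hφ (n : ℕ) (x) : φ ((T ^ n) x) = z ^ n * φ x := by
    have : φ ∘L (T ^ n) = z ^ n • φ := by
      refine lp.ext_continuousLinearMap (by simp) fun i => ?_
      ext
      simp [shift_pow_single hT, hφs, pow_add]
    simpa using DFunLike.congr_fun this x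
  have h : φ (F k) = w * φ k := by
    refine (hasSum_apply_pow hF φ k).unique ((hw.mul_right (φ k)).congr_fun fun n => ?_)
    rw [hφ, smul_eq_mul, mul_assoc]
  have hkk : ‖φ k‖ = ‖k‖ * ‖k‖ := by
    simp [φ, inner_self_eq_norm_sq_to_K, sq]
  have hpos : 0 < ‖k‖ * ‖k‖ := by positivity
  have hle : ‖φ (F k)‖ ≤ ‖k‖ * (‖F‖ * ‖k‖) :=
    (norm_inner_le_norm k (F k)).trans (by gcongr; exact F.le_opNorm k)
  rw [h, norm_mul, hkk] at hle
  refine le_of_mul_le_mul_right ?_ hpos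
  linarith

theorem norm_le_norm_shift_series
    (hT : ∀ n : ℕ, T (lp.single 2 n (1 : ℂ)) = lp.single 2 (n + 1) (1 : ℂ))
    {a : ℕ → ℂ} (ha : Summable fun n => ‖a n‖)
    {F : lp (fun _ : ℕ => ℂ) 2 →L[ℂ] lp (fun _ : ℕ => ℂ) 2}
    (hF : HasSum (fun n : ℕ => a n • (T ^ n)) F)
    {f : ℂ → ℂ} (hf : ∀ z : ℂ, ‖z‖ ≤ 1 → HasSum (fun n : ℕ => a n * z ^ n) (f z))
    {z : ℂ} (hz : ‖z‖ ≤ 1) : ‖f z‖ ≤ ‖F‖ := by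
  have hcont : ContinuousOn f (Metric.closedBall 0 1) := by
    have : ContinuousOn (fun z : ℂ => ∑' n, a n * z ^ n) (Metric.closedBall 0 1) := by
      refine continuousOn_tsum (fun n => by fun_prop) ha fun n x hx => ?_
      rw [norm_mul, norm_pow]
      exact mul_le_of_le_one_right (norm_nonneg _)
        (pow_le_one₀ (norm_nonneg _) (by simpa using hx))
    exact this.congr fun x hx => (hf x (by simpa using hx)).tsum_eq.symm
  have hcl : closure (Metric.ball (0 : ℂ) 1) = Metric.closedBall 0 1 :=
    closure_ball _ one_ne_zero
  refine le_on_closure (s := Metric.ball (0 : ℂ) 1) (f := fun z => ‖f z‖) (g := fun _ => ‖F‖)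
    (fun y hy => ?_) (hcl ▸ hcont.norm) continuousOn_const (by simpa [hcl] using hz)
  have hy' : ‖y‖ < 1 := by simpa using hy
  exact norm_le_norm_shift_series_of_norm_lt_one hT hF hy' (hf y hy'.le)

theorem norm_shift_series_le
    (hT : ∀ n : ℕ, T (lp.single 2 n (1 : ℂ)) = lp.single 2 (n + 1) (1 : ℂ))
    {a : ℕ → ℂ} (ha : Summable fun n => ‖a n‖)
    {F : lp (fun _ : ℕ => ℂ) 2 →L[ℂ] lp (fun _ : ℕ => ℂ) 2}
    (hF : HasSum (fun n : ℕ => a n • (T ^ n)) F)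
    {f : ℂ → ℂ} (hf : ∀ z : ℂ, ‖z‖ ≤ 1 → HasSum (fun n : ℕ => a n * z ^ n) (f z))
    {M : ℝ} (hM : ∀ z : ℂ, ‖z‖ = 1 → ‖f z‖ ≤ M) : ‖F‖ ≤ M := by
  have hM0 : 0 ≤ M := (norm_nonneg _).trans (hM 1 norm_one)
  let L : C(UnitAddCircle, ℂ) →L[ℂ] Lp ℂ 2 (AddCircle.haarAddCircle (T := 1)) :=
    ContinuousMap.toLp (E := ℂ) 2 AddCircle.haarAddCircle ℂ
  have hon : Orthonormal ℂ fun n : ℕ => L (fourier (n : ℤ)) :=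
    (orthonormal_fourier (T := 1)).comp (fun n : ℕ => (n : ℤ)) Nat.cast_injective
  let U := hon.orthogonalFamily.linearIsometry
  have hU (n : ℕ) : U (lp.single 2 n (1 : ℂ)) = L (fourier (n : ℤ)) := by
    simp [U, OrthogonalFamily.linearIsometry_apply_single]
  obtain ⟨g, hg⟩ : Summable fun n : ℕ => a n • (fourier (n : ℤ) : C(UnitAddCircle, ℂ)) :=
    Summable.of_norm (ha.congr fun n => by rw [norm_smul, fourier_norm, mul_one])
  have hgM (t : UnitAddCircle) : ‖g t‖ ≤ M := by
    have h1 : ‖(fourier 1 t : ℂ)‖ = 1 := Circle.norm_coe _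
    have : g t = f (fourier 1 t) := by
      refine (ContinuousMap.hasSum_apply hg t).unique ((hf _ h1.le).congr_fun fun n => ?_)
      rw [ContinuousMap.smul_apply, smul_eq_mul, fourier_apply, fourier_apply, one_zsmul,
        natCast_zsmul, AddCircle.toCircle_nsmul, Circle.coe_pow]
    rw [this]
    exact hM _ h1
  refine F.opNorm_le_bound hM0 fun x => ?_
  have hx : Tendsto (fun s : Finset ℕ => ∑ i ∈ s, (lp.single 2 i (x i) : lp (fun _ : ℕ => ℂ) 2))
      atTop (𝓝 x) := lp.hasSum_single (by simp) x
  refine le_of_tendsto_of_tendsto' ((F.continuous.tendsto x).comp hx).norm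
    (hx.norm.const_mul M) fun s => ?_
  set y : lp (fun _ : ℕ => ℂ) 2 := ∑ i ∈ s, lp.single 2 i (x i)
  let p : C(UnitAddCircle, ℂ) := ∑ i ∈ s, x i • fourier (i : ℤ)
  have hTy (n : ℕ) : U ((T ^ n) y) = L (fourier (n : ℤ) * p) := by
    simp only [y, p, map_sum, Finset.mul_sum]
    refine Finset.sum_congr rfl fun i _ => ?_
    rw [single_eq_smul_one, map_smul, map_smul, shift_pow_single hT, hU, mul_smul_comm, map_smul]
    congr 2
    ext t
    simp only [Nat.cast_add, ContinuousMap.mul_apply, fourier_add]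
  have hFy : U (F y) = L (g * p) := by
    refine (hasSum_apply_pow hF U.toContinuousLinearMap y).unique
      (((hg.mul_right p).mapL L).congr_fun fun n => ?_)
    rw [LinearIsometry.coe_toContinuousLinearMap, hTy, smul_mul_assoc, map_smul]
  have hy : U y = L p := by
    have h0 : (fourier ((0 : ℕ) : ℤ) : C(UnitAddCircle, ℂ)) = 1 := by ext; simp
    simpa only [pow_zero, one_apply_eq_self, h0, one_mul] using hTy 0
  calc ‖F y‖ = ‖L (g * p)‖ := by rw [← hFy, U.norm_map]
    _ ≤ M * ‖L p‖ := norm_toLp_mul_le _ hgM p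
    _ = M * ‖y‖ := by rw [← hy, U.norm_map]

end Shift

/-- Isometry of the functional calculus: for `f(z) = ∑ a n zⁿ` with `(a n) ∈ ℓ¹` and
`T` the unilateral shift on `ℓ²(ℕ)`, `‖f(T)‖ = sup_{|z| ≤ 1} ‖f z‖`. -/
theorem stmt_10
    (T : lp (fun _ : ℕ => ℂ) 2 →L[ℂ] lp (fun _ : ℕ => ℂ) 2)
    (hT : ∀ n : ℕ, T (lp.single 2 n (1 : ℂ)) = lp.single 2 (n + 1) (1 : ℂ))
    (a : ℕ → ℂ) (ha : Summable fun n => ‖a n‖)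
    (F : lp (fun _ : ℕ => ℂ) 2 →L[ℂ] lp (fun _ : ℕ => ℂ) 2)
    (hF : HasSum (fun n : ℕ => a n • (T ^ n)) F)
    (f : ℂ → ℂ) (hf : ∀ z : ℂ, ‖z‖ ≤ 1 → HasSum (fun n : ℕ => a n * z ^ n) (f z)) :
    ‖F‖ = ⨆ z : Metric.closedBall (0 : ℂ) 1, ‖f z‖ := by
  have hle (z : Metric.closedBall (0 : ℂ) 1) : ‖f z‖ ≤ ‖F‖ :=
    norm_le_norm_shift_series hT ha hF hf (mem_closedBall_zero_iff.1 z.2)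
  have : Nonempty (Metric.closedBall (0 : ℂ) 1) := ⟨⟨0, by simp⟩⟩
  refine le_antisymm (norm_shift_series_le hT ha hF hf fun z hz => ?_) (ciSup_le hle)
  exact le_ciSup (f := fun z : Metric.closedBall (0 : ℂ) 1 => ‖f z‖)
    ⟨‖F‖, Set.forall_mem_range.2 hle⟩ ⟨z, by simp [hz]⟩
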